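/- Let f : M → M be a homeomorphism of a compact metric space with finite non-wandering set Ω(f). Then the generalized entropy satisfies o(f) = sup{ [c_{f,ℱ}(n)] : ℱ a finite family of wandering compact neighborhoods of M ∖ Ω(f) that are mutually singular }, where the supremum is taken in the Dedekind–MacNeille completion of the space of orders of growth; moreover the same equality holds if one restricts to families whose elements all have diameter less than any fixed δ > 0. -/

import Mathlib

open Function Metric Set Topology Filter

variable {M : Type*}

/-- Y is a wandering set for f: f^n(Y) ∩ Y = ∅ for all n ≥ 1. -/
def Wandering (f : M → M) (Y : Set M) : Prop :=
  ∀ n : ℕ, 1 ≤ n → f^[n] '' Y ∩ Y = ∅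

/-- The non-wandering set Ω(f). -/
def NonwanderingSet [TopologicalSpace M] (f : M → M) : Set M :=
  {x | ∀ U : Set M, IsOpen U → x ∈ U → ∃ n : ℕ, 1 ≤ n ∧ (f^[n] '' U ∩ U).Nonempty}

/-- The word w (with letters in ℱ ∪ {∞}, where `some j` is the letter Y_j and `none`
is the letter ∞ = complement of ∪ℱ) is a coding of the orbit segment of x. -/
def Codes {L : ℕ} (f : M → M) (Y : Fin L → Set M) {n : ℕ}
    (w : Fin n → Option (Fin L)) (x : M) : Prop :=
  ∀ i : Fin n, (w i).elim (f^[(i : ℕ)] x ∉ ⋃ j, Y j) (fun j => f^[(i : ℕ)] x ∈ Y j)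

/-- 𝒜_n(f,ℱ): the set of all codings of all orbit segments of length n. -/
def CodingWords {L : ℕ} (f : M → M) (Y : Fin L → Set M) (n : ℕ) :
    Set (Fin n → Option (Fin L)) :=
  {w | ∃ x : M, Codes f Y w x}

/-- c_{f,ℱ}(n) = #𝒜_n(f,ℱ). -/
noncomputable def codingCount {L : ℕ} (f : M → M) (Y : Fin L → Set M) (n : ℕ) : ℕ :=
  Nat.card (CodingWords f Y n)

/-- The sets Y₁,…,Y_L are mutually singular: for every N there are a point x and times
t i with f^[t i] x ∈ Y i and |t i − t j| > N for i ≠ j. -/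
def MutuallySingular {L : ℕ} (f : M → M) (Y : Fin L → Set M) : Prop :=
  ∀ N : ℕ, ∃ x : M, ∃ t : Fin L → ℕ,
    (∀ i, f^[t i] x ∈ Y i) ∧ ∀ i j, i ≠ j → N < max (t i - t j) (t j - t i)

/-- E is an (n,ε)-separated set for f. -/
def Separated [MetricSpace M] (f : M → M) (ε : ℝ) (n : ℕ) (E : Set M) : Prop :=
  ∀ x ∈ E, ∀ y ∈ E, x ≠ y → ∃ i : ℕ, i < n ∧ ε ≤ dist (f^[i] x) (f^[i] y)

/-- s_{f,ε}(n): the maximal cardinality of an (n,ε)-separated set. -/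
noncomputable def sepCount [MetricSpace M] (f : M → M) (ε : ℝ) (n : ℕ) : ℕ :=
  sSup {k : ℕ | ∃ E : Finset M, Separated f ε n (E : Set M) ∧ E.card = k}

/-- The full orbit of p under the homeomorphism with inverse g. -/
def FullOrbit (f g : M → M) (p : M) : Set M :=
  {y | ∃ n : ℕ, y = f^[n] p ∨ y = g^[n] p}

/-- The stable set of a set A: points whose forward orbit converges to A. -/
def StableSetOf [MetricSpace M] (f : M → M) (A : Set M) : Set M :=
  {x | Tendsto (fun n => infDist (f^[n] x) A) atTop (nhds 0)}

/-- p is a periodic point of f. -/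
def IsPeriodicPoint (f : M → M) (p : M) : Prop := ∃ k : ℕ, 1 ≤ k ∧ f^[k] p = p

/-- The edge relation of the connection graph: p, q are periodic points with distinct
orbits and W^u(θ(p)) ∩ W^s(θ(q)) ≠ ∅. -/
def Conn [MetricSpace M] (f : M ≃ₜ M) (p q : M) : Prop :=
  IsPeriodicPoint ⇑f p ∧ IsPeriodicPoint ⇑f q ∧
  FullOrbit ⇑f ⇑f.symm p ≠ FullOrbit ⇑f ⇑f.symm q ∧
  (StableSetOf ⇑f.symm (FullOrbit ⇑f ⇑f.symm p) ∩
    StableSetOf ⇑f (FullOrbit ⇑f ⇑f.symm q)).Nonempty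

/-- L = L(f) is the length of the longest directed path in the connection graph. -/
def IsMaxPathLength [MetricSpace M] (f : M ≃ₜ M) (L : ℕ) : Prop :=
  (∃ c : Fin (L + 1) → M, ∀ i : Fin L, Conn f (c i.castSucc) (c i.succ)) ∧
  ∀ m : ℕ, (∃ c : Fin (m + 1) → M, ∀ i : Fin m, Conn f (c i.castSucc) (c i.succ)) → m ≤ L

/-- A topological rendering of the Morse–Smale condition: finite non-wandering set,
all non-wandering points periodic, and the no-tangency consequence of transversality:
if W^u(θ(p)) accumulates on W^s(θ(q)) then it meets it. -/
def MorseSmaleLike [MetricSpace M] (f : M ≃ₜ M) : Prop :=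
  (NonwanderingSet ⇑f).Finite ∧
  (∀ x ∈ NonwanderingSet ⇑f, IsPeriodicPoint ⇑f x) ∧
  ∀ p q : M, IsPeriodicPoint ⇑f p → IsPeriodicPoint ⇑f q →
    (closure (StableSetOf ⇑f.symm (FullOrbit ⇑f ⇑f.symm p)) ∩
      StableSetOf ⇑f (FullOrbit ⇑f ⇑f.symm q)).Nonempty →
    (StableSetOf ⇑f.symm (FullOrbit ⇑f ⇑f.symm p) ∩
      StableSetOf ⇑f (FullOrbit ⇑f ⇑f.symm q)).Nonempty

/-- A family of wandering compact neighborhoods of M ∖ Ω(f) that are mutually singular. -/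
def AdmissibleFamily {M : Type*} [MetricSpace M] (f : M ≃ₜ M) {L : ℕ}
    (Y : Fin L → Set M) : Prop :=
  (∀ i, IsCompact (Y i) ∧ Y i = closure (interior (Y i))) ∧
  (∀ i, Y i ⊆ (NonwanderingSet ⇑f)ᶜ) ∧
  (∀ i, Wandering ⇑f (Y i)) ∧
  MutuallySingular ⇑f Y

theorem Wandering.eq_of_mem {f : M → M} {Y : Set M} (h : Wandering f Y) {x : M} {i j : ℕ}
    (hi : f^[i] x ∈ Y) (hj : f^[j] x ∈ Y) : i = j := by
  have key : ∀ a b : ℕ, a < b → f^[a] x ∈ Y → f^[b] x ∉ Y := by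
    intro a b hab ha hb
    have hmem : f^[b] x ∈ f^[b - a] '' Y ∩ Y := by
      refine ⟨⟨f^[a] x, ha, ?_⟩, hb⟩
      rw [← Function.iterate_add_apply, Nat.sub_add_cancel hab.le]
    rw [h (b - a) (by omega)] at hmem
    exact hmem
  rcases lt_trichotomy i j with hij | hij | hij
  · exact absurd hj (key i j hij hi)
  · exact hij
  · exact absurd hi (key j i hij hj)

theorem Wandering.mono {f : M → M} {Y Z : Set M} (h : Wandering f Z) (hYZ : Y ⊆ Z) :
    Wandering f Y := fun n hn =>
  subset_empty_iff.1 ((inter_subset_inter (image_mono hYZ) hYZ).trans (h n hn).subset)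

theorem exists_wandering_nhd [TopologicalSpace M] {f : M → M} {x : M}
    (hx : x ∈ (NonwanderingSet f)ᶜ) :
    ∃ U : Set M, IsOpen U ∧ x ∈ U ∧ Wandering f U := by
  simp only [NonwanderingSet, mem_compl_iff, mem_ofPred_eq, not_forall, not_exists, not_and,
    not_nonempty_iff_eq_empty] at hx
  obtain ⟨U, hU, hxU, h⟩ := hx
  exact ⟨U, hU, hxU, h⟩

theorem isOpen_compl_nonwanderingSet [TopologicalSpace M] (f : M → M) :
    IsOpen (NonwanderingSet f)ᶜ := by
  rw [isOpen_iff_forall_mem_open]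
  intro x hx
  obtain ⟨U, hU, hxU, h⟩ := exists_wandering_nhd hx
  refine ⟨U, fun y hy hy' => ?_, hU, hxU⟩
  obtain ⟨n, hn, hne⟩ := hy' U hU hy
  exact hne.ne_empty (h n hn)

/-- A compact set of wandering points has a neighborhood which every orbit visits a uniformly
bounded number of times. -/
theorem exists_nhd_card_visits_le [TopologicalSpace M] (f : M → M) {K : Set M}
    (hK : IsCompact K) (hKΩ : K ⊆ (NonwanderingSet f)ᶜ) :
    ∃ V : Set M, IsOpen V ∧ K ⊆ V ∧ ∃ m : ℕ, ∀ (x : M) (Q : Finset ℕ),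
      (∀ i ∈ Q, f^[i] x ∈ V) → Q.card ≤ m := by
  classical
  refine hK.induction_on (p := fun K => ∃ V : Set M, IsOpen V ∧ K ⊆ V ∧
    ∃ m : ℕ, ∀ (x : M) (Q : Finset ℕ), (∀ i ∈ Q, f^[i] x ∈ V) → Q.card ≤ m) ?_ ?_ ?_ ?_
  · refine ⟨∅, isOpen_empty, subset_rfl, 0, fun x Q hQ => ?_⟩
    rw [Nat.le_zero, Finset.card_eq_zero]
    exact Finset.eq_empty_of_forall_notMem hQ
  · rintro s t hst ⟨V, hV, htV, h⟩
    exact ⟨V, hV, hst.trans htV, h⟩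
  · rintro s t ⟨V, hV, hsV, m, hm⟩ ⟨W, hW, htW, k, hk⟩
    refine ⟨V ∪ W, hV.union hW, union_subset_union hsV htW, m + k, fun x Q hQ => ?_⟩
    rw [← Finset.card_filter_add_card_filter_not (fun i => f^[i] x ∈ V)]
    refine add_le_add (hm x _ fun i hi => (Finset.mem_filter.1 hi).2) (hk x _ fun i hi => ?_)
    obtain ⟨hiQ, hi⟩ := Finset.mem_filter.1 hi
    exact (hQ i hiQ).resolve_left hi
  · intro x hx
    obtain ⟨U, hU, hxU, hw⟩ := exists_wandering_nhd (hKΩ hx)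
    refine ⟨U, mem_nhdsWithin_of_mem_nhds (hU.mem_nhds hxU), ⟨U, hU, subset_rfl, 1,
      fun y Q hQ => Finset.card_le_one.2 fun i hi j hj => hw.eq_of_mem (hQ i hi) (hQ j hj)⟩⟩

theorem exists_finite_label [PseudoMetricSpace M] [CompactSpace M] {η : ℝ} (hη : 0 < η) :
    ∃ K : ℕ, ∃ c : M → Fin K, ∀ x y, c x = c y → dist x y < η := by
  obtain ⟨t, -, htf, ht⟩ := finite_cover_balls_of_compact (isCompact_univ (X := M)) (half_pos hη)
  have hc : ∀ x : M, ∃ p : t, dist x p < η / 2 := by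
    intro x
    obtain ⟨p, hp, hxp⟩ := mem_iUnion₂.1 (ht (mem_univ x))
    exact ⟨⟨p, hp⟩, hxp⟩
  choose c hc using hc
  have := htf.to_subtype
  refine ⟨Nat.card t, fun x => Finite.equivFin t (c x), fun x y hxy => ?_⟩
  have hxy : c x = c y := (Finite.equivFin t).injective hxy
  have h1 := hc x
  have h2 := hc y
  rw [hxy] at h1
  linarith [dist_triangle_right x y (c y : M)]

theorem bddAbove_card_separated [MetricSpace M] [CompactSpace M] (f : M → M) {ε : ℝ}
    (hε : 0 < ε) (n : ℕ) :
    BddAbove {k : ℕ | ∃ E : Finset M, Separated f ε n (E : Set M) ∧ E.card = k} := by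
  obtain ⟨K, c, hc⟩ := exists_finite_label (M := M) hε
  refine ⟨Fintype.card (Fin n → Fin K), ?_⟩
  rintro _ ⟨E, hE, rfl⟩
  rw [← Finset.card_univ]
  refine Finset.card_le_card_of_injOn (fun x i => c (f^[(i : ℕ)] x)) (fun _ _ => by simp) ?_
  intro x hx y hy hxy
  by_contra hne
  obtain ⟨i, hi, hd⟩ := hE x hx y hy hne
  exact absurd (hc _ _ (congrFun hxy ⟨i, hi⟩)) (not_lt.2 hd)

theorem exists_spanning_card_eq_sepCount [MetricSpace M] [CompactSpace M] (f : M → M) {ε : ℝ}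
    (hε : 0 < ε) (n : ℕ) :
    ∃ E : Finset M, E.card = sepCount f ε n ∧
      ∀ x, ∃ y ∈ E, ∀ i < n, dist (f^[i] x) (f^[i] y) < ε := by
  classical
  have hb := bddAbove_card_separated f hε n
  obtain ⟨E, hE, hcard⟩ := Nat.sSup_mem (s := {k : ℕ | ∃ E : Finset M, Separated f ε n (E : Set M) ∧
    E.card = k}) ⟨0, ∅, by simp [Separated], rfl⟩ hb
  refine ⟨E, hcard, fun x => ?_⟩
  by_contra! hx
  have hxE : x ∉ E := fun h => by
    obtain ⟨i, -, hi⟩ := hx x h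
    rw [dist_self] at hi
    linarith
  have hins : Separated f ε n ((insert x E : Finset M) : Set M) := by
    intro a ha b hb hab
    rw [Finset.mem_coe, Finset.mem_insert] at ha hb
    rcases ha with rfl | ha <;> rcases hb with rfl | hb
    · exact absurd rfl hab
    · exact hx b hb
    · obtain ⟨i, hi, hd⟩ := hx a ha
      exact ⟨i, hi, by rwa [dist_comm]⟩
    · exact hE a ha b hb hab
  have := le_csSup hb ⟨_, hins, rfl⟩
  rw [Finset.card_insert_of_notMem hxE, ← hcard] at this
  omega

/-- Coding words of a finite family of compact sets of wandering points are, up to a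
multiplicative constant, at most as many as separated orbit segments at a small scale. -/
theorem exists_codingCount_le_sepCount [MetricSpace M] [CompactSpace M] (f : M → M) {L : ℕ}
    (Y : Fin L → Set M) (hY : ∀ i, IsCompact (Y i)) (hYΩ : ∀ i, Y i ⊆ (NonwanderingSet f)ᶜ) :
    ∃ ε : ℝ, 0 < ε ∧ ∃ D : ℕ, ∀ n, codingCount f Y n ≤ D * sepCount f ε n := by
  classical
  rcases isEmpty_or_nonempty M with hM | hM
  · refine ⟨1, one_pos, 0, fun n => ?_⟩
    have : CodingWords f Y n = ∅ := eq_empty_of_forall_notMem fun w ⟨x, _⟩ => hM.elim x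
    simp [codingCount, this]
  have hK : IsCompact (⋃ i, Y i) := isCompact_iUnion hY
  obtain ⟨V, hVo, hKV, m, hm⟩ := exists_nhd_card_visits_le f hK (iUnion_subset hYΩ)
  obtain ⟨ε, hε, hεV⟩ := hK.exists_thickening_subset_open hVo hKV
  refine ⟨ε, hε, (L + 1) ^ m, fun n => ?_⟩
  obtain ⟨E, hEcard, hE⟩ := exists_spanning_card_eq_sepCount f hε n
  have hw : ∀ w : Fin n → Option (Fin L), ∃ y : M, w ∈ CodingWords f Y n →
      y ∈ E ∧ ∀ i, w i ≠ none → f^[(i : ℕ)] y ∈ V := by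
    intro w
    by_cases hw : w ∈ CodingWords f Y n
    · obtain ⟨x, hx⟩ := hw
      obtain ⟨y, hy, hxy⟩ := hE x
      refine ⟨y, fun _ => ⟨hy, fun i hi => ?_⟩⟩
      obtain ⟨j, hj⟩ := Option.ne_none_iff_exists'.1 hi
      have hxi := hx i
      rw [hj] at hxi
      refine hεV (mem_thickening_iff.2 ⟨f^[(i : ℕ)] x, mem_iUnion.2 ⟨j, hxi⟩, ?_⟩)
      rw [dist_comm]
      exact hxy i i.2
    · exact ⟨Classical.arbitrary M, fun h => absurd h hw⟩
  choose φ hφ using hw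
  have hfib : ∀ y ∈ (CodingWords f Y n).toFinset.image φ,
      ((CodingWords f Y n).toFinset.filter fun w => φ w = y).card ≤ (L + 1) ^ m := by
    intro y _
    set Q : Finset (Fin n) := Finset.univ.filter fun i => f^[(i : ℕ)] y ∈ V
    have hQm : Q.card ≤ m := by
      rw [← Finset.card_map Fin.valEmbedding]
      refine hm y _ fun i hi => ?_
      obtain ⟨i', hi', rfl⟩ := Finset.mem_map.1 hi
      exact (Finset.mem_filter.1 hi').2
    calc _ ≤ (Finset.univ : Finset (Q → Option (Fin L))).card := by
          refine Finset.card_le_card_of_injOn (fun w i => w i) (fun _ _ => by simp) ?_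
          intro w hw w' hw' hww
          simp only [Finset.coe_filter, mem_toFinset, mem_ofPred_eq] at hw hw'
          funext i
          by_cases hi : i ∈ Q
          · exact congrFun hww ⟨i, hi⟩
          · have hnone : ∀ v, v ∈ CodingWords f Y n ∧ φ v = y → v i = none := by
              rintro v ⟨hv, rfl⟩
              by_contra hne
              exact hi (Finset.mem_filter.2 ⟨Finset.mem_univ _, (hφ v hv).2 i hne⟩)
            rw [hnone w hw, hnone w' hw']
      _ = (L + 1) ^ Q.card := by simp
      _ ≤ (L + 1) ^ m := Nat.pow_le_pow_right (by omega) hQm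
  calc codingCount f Y n = (CodingWords f Y n).toFinset.card := by
        rw [codingCount, Nat.card_eq_fintype_card, Set.toFinset_card]
    _ ≤ (L + 1) ^ m * ((CodingWords f Y n).toFinset.image φ).card :=
        Finset.card_le_mul_card_image _ _ hfib
    _ ≤ (L + 1) ^ m * sepCount f ε n := by
        refine Nat.mul_le_mul_left _ (hEcard ▸ Finset.card_le_card ?_)
        intro y hy
        obtain ⟨w, hw, rfl⟩ := Finset.mem_image.1 hy
        exact (hφ w (mem_toFinset.1 hw)).1

/-- A finite set of times contains a subset of times pairwise more than `N` apart and such that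
every time is within `N` of it. -/
theorem exists_subset_sparse {ι : Type*} [DecidableEq ι] (t : ι → ℕ) (N : ℕ) (S : Finset ι) :
    ∃ T ⊆ S, (∀ i ∈ T, ∀ j ∈ T, i ≠ j → N < max (t i - t j) (t j - t i)) ∧
      ∀ j ∈ S, ∃ k ∈ T, t j - t k ≤ N ∧ t k - t j ≤ N := by
  induction S using Finset.induction_on with
  | empty => exact ⟨∅, by simp⟩
  | insert a S ha ih =>
    obtain ⟨T, hTS, hT, hS⟩ := ih
    by_cases h : ∃ k ∈ T, t a - t k ≤ N ∧ t k - t a ≤ N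
    · refine ⟨T, hTS.trans (Finset.subset_insert _ _), hT, fun j hj => ?_⟩
      rcases Finset.mem_insert.1 hj with rfl | hj
      · exact h
      · exact hS j hj
    · push Not at h
      refine ⟨insert a T, Finset.insert_subset_insert _ hTS, ?_, ?_⟩
      · intro i hi j hj hij
        rcases Finset.mem_insert.1 hi with rfl | hi <;> rcases Finset.mem_insert.1 hj with rfl | hj
        · exact absurd rfl hij
        · have := h j hj
          omega
        · have := h i ‹_›
          omega
        · exact hT i hi j hj hij
      · intro j hj
        rcases Finset.mem_insert.1 hj with rfl | hj
        · exact ⟨j, Finset.mem_insert_self _ _, by simp⟩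
        · obtain ⟨k, hk, h'⟩ := hS j hj
          exact ⟨k, Finset.mem_insert_of_mem hk, h'⟩

/-- The subfamily indexed by a finite set of indices, enumerated by `Fin`. -/
noncomputable def subfamily {ι : Type*} (Y : ι → Set M) (T : Finset ι) (i : Fin T.card) : Set M :=
  Y (T.equivFin.symm i)

/-- Every point has a coding. -/
theorem exists_codes {L : ℕ} (f : M → M) (Y : Fin L → Set M) (n : ℕ) (x : M) :
    ∃ w : Fin n → Option (Fin L), Codes f Y w x := by
  have : ∀ i : Fin n, ∃ a : Option (Fin L),
      a.elim (f^[(i : ℕ)] x ∉ ⋃ j, Y j) (fun j => f^[(i : ℕ)] x ∈ Y j) := by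
    intro i
    by_cases h : f^[(i : ℕ)] x ∈ ⋃ j, Y j
    · obtain ⟨j, hj⟩ := mem_iUnion.1 h
      exact ⟨some j, hj⟩
    · exact ⟨none, h⟩
  choose w hw using this
  exact ⟨w, hw⟩

/-- A uniform bound witnessing the failure of mutual singularity of subfamilies: a subfamily
visited once at times more than `N` apart is mutually singular. -/
theorem exists_uniform_gap {ι : Type*} [Fintype ι] (f : M → M) (Y : ι → Set M) :
    ∃ N : ℕ, ∀ (T : Finset ι) (x : M) (t : ι → ℕ), (∀ i ∈ T, f^[t i] x ∈ Y i) →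
      (∀ i ∈ T, ∀ j ∈ T, i ≠ j → N < max (t i - t j) (t j - t i)) →
      MutuallySingular f (subfamily Y T) := by
  classical
  have h : ∀ T : Finset ι, ∃ N : ℕ, ∀ (x : M) (t : ι → ℕ), (∀ i ∈ T, f^[t i] x ∈ Y i) →
      (∀ i ∈ T, ∀ j ∈ T, i ≠ j → N < max (t i - t j) (t j - t i)) →
      MutuallySingular f (subfamily Y T) := by
    intro T
    by_contra! h
    obtain ⟨_, _, _, _, hns⟩ := h 0
    refine hns fun N => ?_
    obtain ⟨x, t, hx, ht, -⟩ := h N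
    refine ⟨x, fun i => t (T.equivFin.symm i), fun i => hx _ (T.equivFin.symm i).2,
      fun i j hij => ht _ (T.equivFin.symm i).2 _ (T.equivFin.symm j).2 fun h => hij ?_⟩
    exact T.equivFin.symm.injective (Subtype.ext h)
  choose N hN using h
  refine ⟨Finset.univ.sup N, fun T x t hx ht => hN T x t hx fun i hi j hj hij => ?_⟩
  exact (Finset.le_sup (Finset.mem_univ T)).trans_lt (ht i hi j hj hij)

/-- Finitely many wandering sets, of which all mutually singular subfamilies have coding counts
bounded by `u`: a finite family of points is bounded by `u` if its members are told apart by
the visits of their orbit segments, together with a finite label. -/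
theorem exists_card_le_of_visits {ι κ : Type*} [Fintype ι] [Fintype κ] (f : M → M)
    (Y : ι → Set M) (hY : ∀ i, Wandering f (Y i)) (c : M → κ) (u : ℕ → ℝ) (hu : ∀ n, 0 ≤ u n)
    (hcod : ∀ T : Finset ι, MutuallySingular f (subfamily Y T) →
      ∃ C : ℝ, 0 < C ∧ ∀ n, (codingCount f (subfamily Y T) n : ℝ) ≤ C * u n) :
    ∃ C : ℝ, 0 < C ∧ ∀ (n : ℕ) (E : Finset M),
      (∀ x ∈ E, ∀ y ∈ E, c x = c y →
        (∀ i < n, ∀ j, f^[i] x ∈ Y j ↔ f^[i] y ∈ Y j) → x = y) →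
      (E.card : ℝ) ≤ C * u n := by
  classical
  obtain ⟨N, hN⟩ := exists_uniform_gap f Y
  have hcod' : ∀ T : Finset ι, ∃ C : ℝ, 0 < C ∧ (MutuallySingular f (subfamily Y T) →
      ∀ n, (codingCount f (subfamily Y T) n : ℝ) ≤ C * u n) := by
    intro T
    by_cases h : MutuallySingular f (subfamily Y T)
    · obtain ⟨C, hC, hCn⟩ := hcod T h
      exact ⟨C, hC, fun _ => hCn⟩
    · exact ⟨1, one_pos, fun h' => absurd h' h⟩
  choose C hC hCn using hcod'
  set D : ℕ := Fintype.card ((ι → Option (ι × Fin (N + 1) × Fin (N + 1))) × κ)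
  refine ⟨∑ T : Finset ι, C T * D + 1, ?_, fun n E hE => ?_⟩
  · have : 0 ≤ ∑ T : Finset ι, C T * D :=
      Finset.sum_nonneg fun T _ => mul_nonneg (hC T).le (Nat.cast_nonneg _)
    linarith
  have hdata : ∀ x : M, ∃ (S T : Finset ι) (t : ι → ℕ) (k : ι → ι),
      (∀ j, j ∈ S ↔ ∃ i < n, f^[i] x ∈ Y j) ∧ (∀ j ∈ S, t j < n ∧ f^[t j] x ∈ Y j) ∧ T ⊆ S ∧
      (∀ i ∈ T, ∀ j ∈ T, i ≠ j → N < max (t i - t j) (t j - t i)) ∧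
      ∀ j ∈ S, k j ∈ T ∧ t j - t (k j) ≤ N ∧ t (k j) - t j ≤ N := by
    intro x
    have ht : ∀ j, ∃ i, (∃ i < n, f^[i] x ∈ Y j) → i < n ∧ f^[i] x ∈ Y j := by
      intro j
      by_cases h : ∃ i < n, f^[i] x ∈ Y j
      · obtain ⟨i, hi⟩ := h
        exact ⟨i, fun _ => hi⟩
      · exact ⟨0, fun h' => absurd h' h⟩
    choose t ht using ht
    obtain ⟨T, hTS, hT, hS⟩ := exists_subset_sparse t N
      (Finset.univ.filter fun j => ∃ i < n, f^[i] x ∈ Y j)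
    have hk : ∀ j, ∃ k, (j ∈ Finset.univ.filter fun j => ∃ i < n, f^[i] x ∈ Y j) →
        k ∈ T ∧ t j - t k ≤ N ∧ t k - t j ≤ N := by
      intro j
      by_cases h : j ∈ Finset.univ.filter fun j => ∃ i < n, f^[i] x ∈ Y j
      · obtain ⟨k, hk⟩ := hS j h
        exact ⟨k, fun _ => hk⟩
      · exact ⟨j, fun h' => absurd h' h⟩
    choose k hk using hk
    exact ⟨_, T, t, k, fun j => by simp, fun j hj => ht j (by simpa using hj), hTS, hT, hk⟩
  choose S T t k hS ht hTS hT hk using hdata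
  choose w hw using fun (x : M) (U : Finset ι) => exists_codes f (subfamily Y U) n x
  have hwt : ∀ (x : M) (U : Finset ι), T x = U → ∀ (i : Fin n) (j : ι) (hj : j ∈ U),
      w x U i = some (U.equivFin ⟨j, hj⟩) ↔ (i : ℕ) = t x j := by
    rintro x _ rfl i j hj
    have hj' := ht x j (hTS x hj)
    have hxi := hw x (T x) i
    constructor
    · intro h
      rw [h] at hxi
      simp only [Option.elim_some, subfamily, Equiv.symm_apply_apply] at hxi
      exact (hY j).eq_of_mem hxi hj'.2
    · intro h
      cases hwi : w x (T x) i with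
      | none =>
        rw [hwi] at hxi
        refine absurd (mem_iUnion.2 ⟨(T x).equivFin ⟨j, hj⟩, ?_⟩) hxi
        rw [h]
        simpa [subfamily] using hj'.2
      | some l =>
        rw [hwi] at hxi
        set j' := (T x).equivFin.symm l with hl
        have hl' : l = (T x).equivFin j' := by simp [hl]
        have hx' : f^[(i : ℕ)] x ∈ Y j' := hxi
        have heq : (i : ℕ) = t x j' := (hY j').eq_of_mem hx' (ht x j' (hTS x j'.2)).2
        have : j = j' := by
          by_contra hne
          have := hT x j hj j' j'.2 hne
          omega
        rw [hl', show j' = ⟨j, hj⟩ from Subtype.ext this.symm]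
  have hmem : ∀ x, ∀ i < n, ∀ j, f^[i] x ∈ Y j ↔ j ∈ S x ∧ t x j = i := by
    intro x i hi j
    constructor
    · intro h
      have hj : j ∈ S x := (hS x j).2 ⟨i, hi, h⟩
      exact ⟨hj, (hY j).eq_of_mem (ht x j hj).2 h⟩
    · rintro ⟨hj, rfl⟩
      exact (ht x j hj).2
  have hclamp : ∀ a, a % (N + 1) < N + 1 := fun a => Nat.mod_lt _ (by omega)
  let o : M → ι → Option (ι × Fin (N + 1) × Fin (N + 1)) := fun x j =>
    if j ∈ S x then some (k x j, ⟨_, hclamp (t x j - t x (k x j))⟩,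
      ⟨_, hclamp (t x (k x j) - t x j)⟩) else none
  have hfiber : ∀ U : Finset ι, ((E.filter fun x => T x = U).card : ℝ) ≤ C U * D * u n := by
    intro U
    rcases (E.filter fun x => T x = U).eq_empty_or_nonempty with h0 | ⟨x₀, hx₀⟩
    · rw [h0, Finset.card_empty, Nat.cast_zero]
      exact mul_nonneg (mul_nonneg (hC U).le (Nat.cast_nonneg _)) (hu n)
    have hms : MutuallySingular f (subfamily Y U) := by
      rw [← (Finset.mem_filter.1 hx₀).2]
      exact hN _ x₀ (t x₀) (fun i hi => (ht x₀ i (hTS x₀ hi)).2) (hT x₀)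
    have hle : (E.filter fun x => T x = U).card ≤ codingCount f (subfamily Y U) n * D := by
      calc _ ≤ ((CodingWords f (subfamily Y U) n).toFinset ×ˢ (Finset.univ :
            Finset ((ι → Option (ι × Fin (N + 1) × Fin (N + 1))) × κ))).card := by
            refine Finset.card_le_card_of_injOn (fun x => (w x U, (o x, c x))) ?_ ?_
            · intro x _
              simpa using ⟨x, hw x U⟩
            · intro x hx y hy hxy
              simp only [Finset.coe_filter, mem_ofPred_eq] at hx hy
              simp only [Prod.mk.injEq] at hxy
              obtain ⟨hxE, hxU⟩ := hx
              obtain ⟨hyE, hyU⟩ := hy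
              obtain ⟨hwxy, hoxy, hcxy⟩ := hxy
              have htU : ∀ j ∈ U, t x j = t y j := by
                intro j hj
                have hlt := (ht x j (hTS x (hxU ▸ hj))).1
                have h1 := (hwt x U hxU ⟨t x j, hlt⟩ j hj).2 rfl
                rw [hwxy] at h1
                exact (hwt y U hyU ⟨t x j, hlt⟩ j hj).1 h1
              have ho : ∀ j, (j ∈ S x ↔ j ∈ S y) ∧ (j ∈ S x → t x j = t y j) := by
                intro j
                have hoj := congrFun hoxy j
                by_cases hjx : j ∈ S x <;> by_cases hjy : j ∈ S y
                · simp only [o, if_pos hjx, if_pos hjy, Option.some.injEq, Prod.mk.injEq,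
                    Fin.mk.injEq] at hoj
                  obtain ⟨hk1, h1, h2⟩ := hoj
                  obtain ⟨hkx, hx1, hx2⟩ := hk x j hjx
                  obtain ⟨-, hy1, hy2⟩ := hk y j hjy
                  have h3 := htU (k x j) (hxU ▸ hkx)
                  rw [← hk1] at h1 h2 hy1 hy2
                  rw [Nat.mod_eq_of_lt (by omega), Nat.mod_eq_of_lt (by omega)] at h1 h2
                  exact ⟨iff_of_true hjx hjy, fun _ => by omega⟩
                · simp [o, hjx, hjy] at hoj
                · simp [o, hjx, hjy] at hoj
                · exact ⟨iff_of_false hjx hjy, fun h => absurd h hjx⟩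
              refine hE x hxE y hyE hcxy fun i hi j => ?_
              rw [hmem x i hi, hmem y i hi, ← (ho j).1]
              exact and_congr_right fun hj => by rw [(ho j).2 hj]
        _ = codingCount f (subfamily Y U) n * D := by
            rw [Finset.card_product, Finset.card_univ, codingCount, Nat.card_eq_fintype_card,
              Set.toFinset_card]
    calc ((E.filter fun x => T x = U).card : ℝ)
        ≤ (codingCount f (subfamily Y U) n : ℝ) * D := by exact_mod_cast hle
      _ ≤ C U * u n * D := by gcongr; exact hCn U hms n
      _ = C U * D * u n := by ring
  calc (E.card : ℝ) = ∑ U : Finset ι, ((E.filter fun x => T x = U).card : ℝ) := by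
        rw [Finset.card_eq_sum_card_fiberwise (f := T) (t := Finset.univ) (fun _ _ => by simp)]
        push_cast
        rfl
    _ ≤ ∑ U : Finset ι, C U * D * u n := Finset.sum_le_sum fun U _ => hfiber U
    _ = (∑ U : Finset ι, C U * D) * u n := (Finset.sum_mul _ _ _).symm
    _ ≤ (∑ U : Finset ι, C U * D + 1) * u n := by
        have := hu n
        nlinarith

/-- Distinct points of a finite set are uniformly separated. -/
theorem exists_pos_le_dist_of_finite [MetricSpace M] {s : Set M} (hs : s.Finite) :
    ∃ ρ : ℝ, 0 < ρ ∧ ∀ x ∈ s, ∀ y ∈ s, x ≠ y → ρ ≤ dist x y := by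
  by_cases h : s.Nontrivial
  · exact ⟨s.infsep, hs.infsep_pos_iff_nontrivial.2 h, fun x hx y hy hxy =>
      infsep_le_dist_of_mem hx hy hxy⟩
  · exact ⟨1, one_pos, fun x hx y hy hxy => absurd ⟨x, hx, y, hy, hxy⟩ h⟩

/-- Separated sets are bounded by `u` as soon as the coding counts of all admissible families of
small diameter are. -/
theorem exists_sepCount_le [MetricSpace M] [CompactSpace M] (f : M ≃ₜ M)
    (hΩfin : (NonwanderingSet f).Finite) (u : ℕ → ℝ) (hu : ∀ n, 0 ≤ u n) {δ : ℝ} (hδ : 0 < δ)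
    (hcod : ∀ L : ℕ, ∀ Y : Fin L → Set M, AdmissibleFamily f Y → (∀ i, Metric.diam (Y i) < δ) →
      ∃ C : ℝ, 0 < C ∧ ∀ n : ℕ, (codingCount f Y n : ℝ) ≤ C * u n) {ε : ℝ} (hε : 0 < ε) :
    ∃ C : ℝ, 0 < C ∧ ∀ n : ℕ, (sepCount f ε n : ℝ) ≤ C * u n := by
  obtain ⟨ρ, hρ, hΩρ⟩ := exists_pos_le_dist_of_finite hΩfin
  obtain ⟨η', hη', hfη'⟩ := Metric.uniformContinuous_iff.1
    (CompactSpace.uniformContinuous_of_continuous f.continuous) (ρ / 3) (by positivity)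
  set η := min ε η'
  have hη : 0 < η := lt_min hε hη'
  have hfη : ∀ {a b : M}, dist a b < η → dist (f a) (f b) < ρ / 3 := fun h =>
    hfη' (h.trans_le (min_le_right _ _))
  set r := min (η / 2) (ρ / 3)
  have hr : 0 < r := lt_min (half_pos hη) (by positivity)
  have hrη : r ≤ η / 2 := min_le_left _ _
  have hrρ : r ≤ ρ / 3 := min_le_right _ _
  set K : Set M := (⋃ p ∈ NonwanderingSet f, ball p r)ᶜ
  have hK : IsCompact K :=
    (isOpen_biUnion fun _ _ => isOpen_ball).isClosed_compl.isCompact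
  have hKΩ : ∀ x ∈ K, x ∈ (NonwanderingSet f)ᶜ := fun x hx hxΩ =>
    hx (mem_iUnion₂.2 ⟨x, hxΩ, mem_ball_self hr⟩)
  have hball : ∀ x ∈ (NonwanderingSet f)ᶜ, ∃ s : ℝ, 0 < s ∧ 2 * s < min η δ ∧
      Wandering f (closedBall x s) ∧ closedBall x s ⊆ (NonwanderingSet f)ᶜ := by
    intro x hx
    obtain ⟨U, hU, hxU, hw⟩ := exists_wandering_nhd hx
    obtain ⟨s, hs, hsU⟩ := Metric.nhds_basis_closedBall.mem_iff.1
      (inter_mem (hU.mem_nhds hxU) ((isOpen_compl_nonwanderingSet f).mem_nhds hx))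
    have hm : 0 < min η δ := lt_min hη hδ
    have hsub : closedBall x (min s (min η δ / 3)) ⊆ U ∩ (NonwanderingSet f)ᶜ :=
      (closedBall_subset_closedBall (min_le_left _ _)).trans hsU
    refine ⟨min s (min η δ / 3), lt_min hs (by positivity), ?_,
      hw.mono (hsub.trans inter_subset_left), hsub.trans inter_subset_right⟩
    linarith [min_le_right s (min η δ / 3)]
  choose! s hs hsη hsw hsΩ using hball
  obtain ⟨F, hFK, hF⟩ := hK.elim_nhds_subcover (fun x => ball x (s x)) fun x hx =>
    ball_mem_nhds x (hs x (hKΩ x hx))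
  let Y : F → Set M := fun x => closure (ball (x : M) (s x))
  have hYsub : ∀ x : F, Y x ⊆ closedBall (x : M) (s x) := fun x => closure_ball_subset_closedBall
  have hFΩ : ∀ x : F, (x : M) ∈ (NonwanderingSet f)ᶜ := fun x => hKΩ x (hFK x x.2)
  have hdiam : ∀ x : F, diam (Y x) < min η δ := fun x =>
    (diam_mono (hYsub x) isBounded_closedBall).trans_lt
      ((diam_closedBall (hs x (hFΩ x)).le).trans_lt (hsη x (hFΩ x)))
  have hYw : ∀ x : F, Wandering f (Y x) := fun x => (hsw x (hFΩ x)).mono (hYsub x)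
  have hYdist : ∀ (j : F) (a b : M), a ∈ Y j → b ∈ Y j → dist a b < η := fun j a b ha hb =>
    (dist_le_diam_of_mem (isBounded_closedBall.subset (hYsub j)) ha hb).trans_lt
      ((hdiam j).trans_le (min_le_left _ _))
  have hcover : ∀ x, (∀ j, x ∉ Y j) → ∃ p ∈ NonwanderingSet f, dist x p < r := by
    intro x hx
    by_contra hcon
    have hxK : x ∈ K := fun hx' => by
      obtain ⟨p, hp, hxp⟩ := mem_iUnion₂.1 hx'
      exact hcon ⟨p, hp, hxp⟩
    obtain ⟨j, hj, hxj⟩ := mem_iUnion₂.1 (hF hxK)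
    exact hx ⟨j, hj⟩ (subset_closure hxj)
  obtain ⟨L, c, hc⟩ := exists_finite_label (M := M) hη
  obtain ⟨C, hC, hCn⟩ := exists_card_le_of_visits f Y hYw c u hu fun T hT => by
    refine hcod _ _ ⟨fun i => ⟨isClosed_closure.isCompact, ?_⟩, fun i => ?_, fun i => hYw _, hT⟩
      fun i => (hdiam _).trans_le (min_le_right _ _)
    · have := closure_interior_idem
        (s := ball ((T.equivFin.symm i : F) : M) (s (T.equivFin.symm i : F)))
      rw [isOpen_ball.interior_eq] at this
      exact this.symm
    · exact (hYsub _).trans (hsΩ _ (hFΩ _))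
  refine ⟨C, hC, fun n => ?_⟩
  obtain ⟨E, hE, hEcard⟩ := Nat.sSup_mem
    (s := {k : ℕ | ∃ E : Finset M, Separated f ε n (E : Set M) ∧ E.card = k})
    ⟨0, ∅, by simp [Separated], rfl⟩ (bddAbove_card_separated f hε n)
  rw [sepCount, ← hEcard]
  refine hCn n E fun x hx y hy hcxy hvis => ?_
  by_contra hne
  obtain ⟨m, hm, hd⟩ := hE x hx y hy hne
  have hclose : ∀ i < n, dist (f^[i] x) (f^[i] y) < η := by
    intro i
    induction i with
    | zero => exact fun _ => hc x y hcxy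
    | succ i ih =>
      intro hi
      by_cases hj : ∃ j, f^[i + 1] x ∈ Y j
      · obtain ⟨j, hj⟩ := hj
        exact hYdist j _ _ hj ((hvis _ hi j).1 hj)
      · push Not at hj
        obtain ⟨p, hp, hxp⟩ := hcover _ hj
        obtain ⟨q, hq, hyq⟩ := hcover (f^[i + 1] y) fun j hy' => hj j ((hvis _ hi j).2 hy')
        have h1 : dist (f^[i + 1] x) (f^[i + 1] y) < ρ / 3 := by
          rw [iterate_succ_apply', iterate_succ_apply']
          exact hfη (ih (by omega))
        have hpq : p = q := by
          by_contra hpq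
          have h2 := hΩρ p hp q hq hpq
          have h3 := dist_triangle4 p (f^[i + 1] x) (f^[i + 1] y) q
          rw [dist_comm p (f^[i + 1] x)] at h3
          linarith
        subst hpq
        linarith [dist_triangle_right (f^[i + 1] x) (f^[i + 1] y) p]
  linarith [hclose m hm, min_le_left ε η']

/-- for a homeomorphism of a compact metric space with finite non-wandering
set, the generalized entropy o(f) = sup_{ε>0} [s_{f,ε}(n)] equals
sup { [c_{f,ℱ}(n)] : ℱ a finite mutually singular family of wandering compact
neighborhoods of M ∖ Ω(f) }, and the same holds restricting to families of diameter < δ.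
Equality of the two suprema in the Dedekind–MacNeille completion of the space 𝕆 of orders
of growth is expressed intrinsically: the two families of classes have exactly the same
upper bounds u in 𝕆. -/
theorem generalized_entropy_eq_sup_coding {M : Type*} [MetricSpace M] [CompactSpace M]
    (f : M ≃ₜ M) (hΩfin : (NonwanderingSet ⇑f).Finite) :
    ∀ u : ℕ → ℝ, Monotone u → (∀ n, 0 ≤ u n) →
      (((∀ ε : ℝ, 0 < ε → ∃ C : ℝ, 0 < C ∧ ∀ n : ℕ, (sepCount ⇑f ε n : ℝ) ≤ C * u n) ↔
        (∀ L : ℕ, ∀ Y : Fin L → Set M, AdmissibleFamily f Y →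
          ∃ C : ℝ, 0 < C ∧ ∀ n : ℕ, (codingCount ⇑f Y n : ℝ) ≤ C * u n)) ∧
      ∀ δ : ℝ, 0 < δ →
        ((∀ ε : ℝ, 0 < ε → ∃ C : ℝ, 0 < C ∧ ∀ n : ℕ, (sepCount ⇑f ε n : ℝ) ≤ C * u n) ↔
          (∀ L : ℕ, ∀ Y : Fin L → Set M, AdmissibleFamily f Y →
            (∀ i, Metric.diam (Y i) < δ) →
            ∃ C : ℝ, 0 < C ∧ ∀ n : ℕ, (codingCount ⇑f Y n : ℝ) ≤ C * u n))) := by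
  intro u _ hu
  have hle : (∀ ε : ℝ, 0 < ε → ∃ C : ℝ, 0 < C ∧ ∀ n : ℕ, (sepCount ⇑f ε n : ℝ) ≤ C * u n) →
      ∀ L : ℕ, ∀ Y : Fin L → Set M, AdmissibleFamily f Y →
        ∃ C : ℝ, 0 < C ∧ ∀ n : ℕ, (codingCount ⇑f Y n : ℝ) ≤ C * u n := by
    intro h L Y hY
    obtain ⟨ε, hε, D, hD⟩ := exists_codingCount_le_sepCount f Y (fun i => (hY.1 i).1) hY.2.1
    obtain ⟨C, hC, hCn⟩ := h ε hε
    refine ⟨(D + 1) * C, by positivity, fun n => ?_⟩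
    calc (codingCount f Y n : ℝ) ≤ D * sepCount f ε n := by exact_mod_cast hD n
      _ ≤ (D + 1) * sepCount f ε n := by gcongr; linarith
      _ ≤ (D + 1) * (C * u n) := by gcongr; exact hCn n
      _ = (D + 1) * C * u n := by ring
  refine ⟨⟨hle, fun h ε hε => ?_⟩, fun δ hδ => ⟨fun h L Y hY _ => hle h L Y hY, fun h ε hε => ?_⟩⟩
  · exact exists_sepCount_le f hΩfin u hu one_pos (fun L Y hY _ => h L Y hY) hε
  · exact exists_sepCount_le f hΩfin u hu hδ h hε
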